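/- Let Q be a finite set of points contained in the unit square R = [0,1]×[0,1], and let W be a finite family of axis-parallel unit squares in general position, each containing exactly one of the two top corners c₁ = (0,1) and c₂ = (1,1) of R, such that some subfamily of W covers Q. Then there exist a subfamily S ⊆ W covering Q with ply(S) = ply*(Q,W), a subset M ⊆ S with |M| ≤ 1, and a real number c, such that every square of S∖M containing c₁ is contained in the half-plane {x ≤ c} and every square of S∖M containing c₂ is contained in the half-plane {x ≥ c}. -/

import Mathlib

open Set

noncomputable section

/-- The axis-parallel unit square `[a,a+1] × [b,b+1]` in `ℝ²`. -/
def unitSq (a b : ℝ) : Set (ℝ × ℝ) :=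
  Set.Icc a (a + 1) ×ˢ Set.Icc b (b + 1)

/-- A set is an axis-parallel unit square. -/
def IsUnitSquare (s : Set (ℝ × ℝ)) : Prop := ∃ a b : ℝ, s = unitSq a b

/-- A finite family `S` covers a point set `Q`. -/
def Covers (S : Finset (Set (ℝ × ℝ))) (Q : Set (ℝ × ℝ)) : Prop :=
  Q ⊆ ⋃ s ∈ S, s

/-- Number of members of `S` containing the point `p`. -/
def plyAt (S : Finset (Set (ℝ × ℝ))) (p : ℝ × ℝ) : ℕ :=
  {s : Set (ℝ × ℝ) | s ∈ S ∧ p ∈ s}.ncard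

/-- The ply of a finite family of subsets of `ℝ²`: the maximum, over points `p`,
of the number of members containing `p`. -/
def ply (S : Finset (Set (ℝ × ℝ))) : ℕ :=
  sSup {n : ℕ | ∃ p : ℝ × ℝ, n = plyAt S p}

/-- The minimum ply cover number of `Q` with `W`. -/
def plyStar (Q : Set (ℝ × ℝ)) (W : Finset (Set (ℝ × ℝ))) : ℕ :=
  sInf {n : ℕ | ∃ S : Finset (Set (ℝ × ℝ)), S ⊆ W ∧ Covers S Q ∧ ply S = n}

/-- General position: no two distinct squares of the family have edges lying on a
common vertical or horizontal line. -/
def GeneralPosition (W : Finset (Set (ℝ × ℝ))) : Prop :=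
  ∀ s ∈ W, ∀ t ∈ W, s ≠ t →
    ∀ a b a' b' : ℝ, s = unitSq a b → t = unitSq a' b' →
      a ≠ a' ∧ a ≠ a' + 1 ∧ a + 1 ≠ a' ∧ b ≠ b' ∧ b ≠ b' + 1 ∧ b + 1 ≠ b'

noncomputable instance : DecidableEq (Set (ℝ × ℝ)) := Classical.decEq _

lemma mem_unitSq {a b : ℝ} {p : ℝ × ℝ} :
    p ∈ unitSq a b ↔ (a ≤ p.1 ∧ p.1 ≤ a + 1) ∧ b ≤ p.2 ∧ p.2 ≤ b + 1 :=
  Iff.rfl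

lemma plyAt_le_card (S : Finset (Set (ℝ × ℝ))) (p : ℝ × ℝ) : plyAt S p ≤ S.card := by
  rw [← Set.ncard_coe_finset S]
  exact Set.ncard_le_ncard (fun s hs => hs.1) S.finite_toSet

lemma plyAt_mono {S T : Finset (Set (ℝ × ℝ))} (h : S ⊆ T) (p : ℝ × ℝ) :
    plyAt S p ≤ plyAt T p :=
  Set.ncard_le_ncard (fun _ hs => ⟨h hs.1, hs.2⟩) (T.finite_toSet.subset fun _ hs => hs.1)

lemma ply_mono {S T : Finset (Set (ℝ × ℝ))} (h : S ⊆ T) : ply S ≤ ply T := by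
  refine csSup_le' ?_
  rintro _ ⟨p, rfl⟩
  refine (plyAt_mono h p).trans (le_csSup ⟨T.card, ?_⟩ ⟨p, rfl⟩)
  rintro _ ⟨q, rfl⟩
  exact plyAt_le_card T q

/-- Some minimum ply cover is irredundant: each of its members has a private point of `Q`. -/
lemma exists_irredundant_min_ply_cover {Q : Set (ℝ × ℝ)} {W : Finset (Set (ℝ × ℝ))}
    (hcov : ∃ S : Finset (Set (ℝ × ℝ)), S ⊆ W ∧ Covers S Q) :
    ∃ S : Finset (Set (ℝ × ℝ)), S ⊆ W ∧ Covers S Q ∧ ply S = plyStar Q W ∧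
      ∀ s ∈ S, ∃ q ∈ Q, q ∈ s ∧ ∀ t ∈ S, t ≠ s → q ∉ t := by
  have hne : {n : ℕ | ∃ S : Finset (Set (ℝ × ℝ)), S ⊆ W ∧ Covers S Q ∧ ply S = n}.Nonempty := by
    obtain ⟨S, hSW, hS⟩ := hcov
    exact ⟨_, S, hSW, hS, rfl⟩
  have hfin : {S : Finset (Set (ℝ × ℝ)) | S ⊆ W ∧ Covers S Q ∧ ply S = plyStar Q W}.Finite :=
    W.powerset.finite_toSet.subset fun S hS => Finset.mem_coe.2 (Finset.mem_powerset.2 hS.1)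
  obtain ⟨S, hmin⟩ := hfin.exists_minimal (Nat.sInf_mem hne)
  obtain ⟨hSW, hS, hply⟩ := hmin.prop
  refine ⟨S, hSW, hS, hply, fun s hs => ?_⟩
  by_contra! hred
  have hcov' : Covers (S.erase s) Q := by
    intro q hq
    obtain ⟨u, hu, hqu⟩ := Set.mem_iUnion₂.1 (hS hq)
    by_cases hus : u = s
    · obtain ⟨t, ht, hts, hqt⟩ := hred q hq (hus ▸ hqu)
      exact Set.mem_iUnion₂.2 ⟨t, Finset.mem_erase.2 ⟨hts, ht⟩, hqt⟩
    · exact Set.mem_iUnion₂.2 ⟨u, Finset.mem_erase.2 ⟨hus, hu⟩, hqu⟩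
  have hsub : S.erase s ⊆ W := (Finset.erase_subset s S).trans hSW
  have hply' : ply (S.erase s) = plyStar Q W :=
    le_antisymm (hply ▸ ply_mono (Finset.erase_subset s S))
      (Nat.sInf_le ⟨_, hsub, hcov', rfl⟩)
  exact Finset.notMem_erase s S
    (hmin.le_of_le ⟨hsub, hcov', hply'⟩ (Finset.erase_subset s S) hs)

/-- There is a minimum ply cover `S` of `Q` such that, after removing at most
one square `M`, the squares containing the top-left corner and the squares containing the
top-right corner are separated by a vertical line `x = c`. -/
theorem exists_min_ply_cover_separated_by_vertical_line
    (Q : Finset (ℝ × ℝ)) (W : Finset (Set (ℝ × ℝ)))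
    (hQ : (↑Q : Set (ℝ × ℝ)) ⊆ unitSq 0 0)
    (hW : ∀ s ∈ W, IsUnitSquare s)
    (hGP : GeneralPosition W)
    (hcorner : ∀ s ∈ W, Xor' (((0 : ℝ), (1 : ℝ)) ∈ s) (((1 : ℝ), (1 : ℝ)) ∈ s))
    (hcov : ∃ S : Finset (Set (ℝ × ℝ)), S ⊆ W ∧ Covers S ↑Q) :
    ∃ S : Finset (Set (ℝ × ℝ)), S ⊆ W ∧ Covers S ↑Q ∧ ply S = plyStar ↑Q W ∧
      ∃ M ⊆ S, M.card ≤ 1 ∧ ∃ c : ℝ,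
        (∀ s ∈ S \ M, ((0 : ℝ), (1 : ℝ)) ∈ s → s ⊆ {p : ℝ × ℝ | p.1 ≤ c}) ∧
        (∀ s ∈ S \ M, ((1 : ℝ), (1 : ℝ)) ∈ s → s ⊆ {p : ℝ × ℝ | c ≤ p.1}) := by
  classical
  obtain ⟨S, hSW, hS, hply, hpriv⟩ := exists_irredundant_min_ply_cover hcov
  refine ⟨S, hSW, hS, hply, ?_⟩
  choose! a b hab using hW
  have mem_iff (s) (hs : s ∈ S) (p : ℝ × ℝ) :
      p ∈ s ↔ (a s ≤ p.1 ∧ p.1 ≤ a s + 1) ∧ b s ≤ p.2 ∧ p.2 ≤ b s + 1 := by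
    rw [← mem_unitSq, ← hab s (hSW hs)]
  have hleft (s) (hs : s ∈ S) (h : ((0 : ℝ), (1 : ℝ)) ∈ s) :
      -1 ≤ a s ∧ a s < 0 ∧ 0 ≤ b s ∧ b s ≤ 1 := by
    have hc : ((1 : ℝ), (1 : ℝ)) ∉ s := by
      rcases hcorner s (hSW hs) with h' | h'
      · exact h'.2
      · exact absurd h h'.2
    rw [mem_iff s hs] at h hc
    obtain ⟨⟨h1, h2⟩, h3, h4⟩ := h
    dsimp only at h1 h2 h3 h4 hc
    refine ⟨by linarith, ?_, by linarith, h3⟩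
    by_contra! hlt
    exact hc ⟨⟨by linarith, by linarith⟩, h3, h4⟩
  have hright (s) (hs : s ∈ S) (h : ((1 : ℝ), (1 : ℝ)) ∈ s) :
      0 < a s ∧ a s ≤ 1 ∧ 0 ≤ b s ∧ b s ≤ 1 := by
    have hc : ((0 : ℝ), (1 : ℝ)) ∉ s := by
      rcases hcorner s (hSW hs) with h' | h'
      · exact absurd h h'.2
      · exact h'.2
    rw [mem_iff s hs] at h hc
    obtain ⟨⟨h1, h2⟩, h3, h4⟩ := h
    dsimp only at h1 h2 h3 h4 hc
    refine ⟨?_, h1, by linarith, h3⟩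
    by_contra! hlt
    exact hc ⟨⟨hlt, by linarith⟩, h3, h4⟩
  have subset_left (s) (hs : s ∈ S) (c : ℝ) (h : a s + 1 ≤ c) : s ⊆ {p : ℝ × ℝ | p.1 ≤ c} :=
    fun p hp => ((mem_iff s hs p).1 hp).1.2.trans h
  have subset_right (s) (hs : s ∈ S) (c : ℝ) (h : c ≤ a s) : s ⊆ {p : ℝ × ℝ | c ≤ p.1} :=
    fun p hp => h.trans ((mem_iff s hs p).1 hp).1.1
  have hpriv' (s) (hs : s ∈ S) : ∃ q : ℝ × ℝ,
      (0 ≤ q.1 ∧ q.1 ≤ 1 ∧ 0 ≤ q.2 ∧ q.2 ≤ 1) ∧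
      ((a s ≤ q.1 ∧ q.1 ≤ a s + 1) ∧ b s ≤ q.2 ∧ q.2 ≤ b s + 1) ∧
      ∀ t ∈ S, t ≠ s → ¬((a t ≤ q.1 ∧ q.1 ≤ a t + 1) ∧ b t ≤ q.2 ∧ q.2 ≤ b t + 1) := by
    obtain ⟨q, hq, hqs, hqt⟩ := hpriv s hs
    obtain ⟨⟨h1, h2⟩, h3, h4⟩ := mem_unitSq.1 (hQ hq)
    refine ⟨q, ⟨h1, by linarith, h3, by linarith⟩, (mem_iff s hs q).1 hqs, fun t ht hts h => ?_⟩
    exact hqt t ht hts ((mem_iff t ht q).2 h)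
  rcases (S.filter fun s => ((0 : ℝ), (1 : ℝ)) ∈ s).eq_empty_or_nonempty with hL | hL
  · refine ⟨∅, Finset.empty_subset S, by simp, 0, fun s hs h => ?_, fun s hs h => ?_⟩ <;>
      have hs := (Finset.mem_sdiff.1 hs).1
    · exact absurd h (Finset.filter_eq_empty_iff.1 hL hs)
    · exact subset_right s hs 0 (hright s hs h).1.le
  rcases (S.filter fun s => ((1 : ℝ), (1 : ℝ)) ∈ s).eq_empty_or_nonempty with hR | hR
  · refine ⟨∅, Finset.empty_subset S, by simp, 1, fun s hs h => ?_, fun s hs h => ?_⟩ <;>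
      have hs := (Finset.mem_sdiff.1 hs).1
    · exact subset_left s hs 1 (by linarith [(hleft s hs h).2.1])
    · exact absurd h (Finset.filter_eq_empty_iff.1 hR hs)
  obtain ⟨l, hl, hlmax⟩ := Finset.exists_max_image _ a hL
  obtain ⟨r, hr, hrmin⟩ := Finset.exists_min_image _ a hR
  rw [Finset.mem_filter] at hl hr
  obtain ⟨l1, l2, l3, l4⟩ := hleft l hl.1 hl.2
  obtain ⟨r1, r2, r3, r4⟩ := hright r hr.1 hr.2
  have hlr : l ≠ r := by rintro rfl; linarith
  rcases le_total (b l) (b r) with hb | hb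
  · refine ⟨{r}, by simpa using hr.1, by simp, a l + 1, fun s hs h => ?_, fun t ht h => ?_⟩
    · have hs := (Finset.mem_sdiff.1 hs).1
      exact subset_left s hs _ (by linarith [hlmax s (Finset.mem_filter.2 ⟨hs, h⟩)])
    obtain ⟨ht, htr⟩ := Finset.mem_sdiff.1 ht
    rw [Finset.mem_singleton] at htr
    refine subset_right t ht _ ?_
    by_contra! hlt
    obtain ⟨t1, t2, t3, t4⟩ := hright t ht h
    have hrt := hrmin t (Finset.mem_filter.2 ⟨ht, h⟩)
    obtain ⟨q, ⟨q1, q2, q3, q4⟩, ⟨⟨q5, q6⟩, q7, q8⟩, hq⟩ := hpriv' r hr.1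
    have hx : a l + 1 < q.1 := by
      by_contra! hx
      exact hq l hl.1 hlr ⟨⟨by linarith, hx⟩, by linarith, by linarith⟩
    have hy : q.2 < b t := by
      by_contra! hy
      exact hq t ht htr ⟨⟨by linarith, by linarith⟩, hy, by linarith⟩
    obtain ⟨p, ⟨p1, p2, p3, p4⟩, ⟨⟨p5, p6⟩, p7, p8⟩, hp⟩ := hpriv' t ht
    exact hp r hr.1 (Ne.symm htr) ⟨⟨by linarith, by linarith⟩, by linarith, by linarith⟩
  · refine ⟨{l}, by simpa using hl.1, by simp, a r, fun t ht h => ?_, fun s hs h => ?_⟩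
    · obtain ⟨ht, htl⟩ := Finset.mem_sdiff.1 ht
      rw [Finset.mem_singleton] at htl
      refine subset_left t ht _ ?_
      by_contra! hlt
      obtain ⟨t1, t2, t3, t4⟩ := hleft t ht h
      have htl' := hlmax t (Finset.mem_filter.2 ⟨ht, h⟩)
      obtain ⟨q, ⟨q1, q2, q3, q4⟩, ⟨⟨q5, q6⟩, q7, q8⟩, hq⟩ := hpriv' l hl.1
      have hx : q.1 < a r := by
        by_contra! hx
        exact hq r hr.1 hlr.symm ⟨⟨hx, by linarith⟩, by linarith, by linarith⟩
      have hy : q.2 < b t := by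
        by_contra! hy
        exact hq t ht htl ⟨⟨by linarith, by linarith⟩, hy, by linarith⟩
      obtain ⟨p, ⟨p1, p2, p3, p4⟩, ⟨⟨p5, p6⟩, p7, p8⟩, hp⟩ := hpriv' t ht
      exact hp l hl.1 (Ne.symm htl) ⟨⟨by linarith, by linarith⟩, by linarith, by linarith⟩
    · have hs := (Finset.mem_sdiff.1 hs).1
      exact subset_right s hs _ (hrmin s (Finset.mem_filter.2 ⟨hs, h⟩))
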